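/- arXiv:2504.09409 — 4 statements merged into one kernel-verified Lean document; each statement's English description precedes it below -/
import Mathlib

section
/- Let d ≥ 1, p ≥ 2, ν > 0, and let f : ℝ^d → ℝ be L_f-smooth, i.e. ‖∇f(x) − ∇f(y)‖₂ ≤ L_f‖x − y‖₂ for all x, y. Let u be a random vector in ℝ^d with E_u[u uᵀ] = I_d and with finite third moment E_u[‖u‖₂³]. Then for every x ∈ ℝ^d, the smoothed gradient g_ν(x) = E_u[((f(x + νu) − f(x))/ν)·u] satisfies ‖g_ν(x) − ∇f(x)‖_p ≤ (ν L_f / 2)·E_u[‖u‖₂³]. -/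
open MeasureTheory Finset
open scoped RealInnerProductSpace

/-- The ℓ_p norm on ℝ^d. -/
noncomputable def lpNorm {d : ℕ} (p : ℝ) (x : EuclideanSpace ℝ (Fin d)) : ℝ :=
  (∑ i, |x i| ^ p) ^ (1 / p)

/-- For `p ≥ 2` the `ℓ_p` norm is bounded by the Euclidean norm. -/
theorem lpNorm_le_norm {d : ℕ} {p : ℝ} (hp : 2 ≤ p) (x : EuclideanSpace ℝ (Fin d)) :
    lpNorm p x ≤ ‖x‖ := by
  have hp0 : 0 < p := by linarith
  have hsplit : ∀ a : ℝ, 0 ≤ a → a ^ p = a ^ 2 * a ^ (p - 2) := fun a ha => by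
    rw [← Real.rpow_natCast a 2, ← Real.rpow_add_of_nonneg ha (by norm_num) (by linarith)]
    congr 1
    push_cast
    ring
  have hsum : ∑ i, |x i| ^ p ≤ ‖x‖ ^ p := by
    calc ∑ i, |x i| ^ p ≤ ∑ i, |x i| ^ 2 * ‖x‖ ^ (p - 2) := by
          refine Finset.sum_le_sum fun i _ => ?_
          rw [hsplit _ (abs_nonneg _)]
          have hi : |x i| ≤ ‖x‖ := PiLp.norm_apply_le x i
          have := Real.rpow_le_rpow (abs_nonneg _) hi (sub_nonneg.2 hp)
          gcongr
      _ = ‖x‖ ^ p := by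
          rw [hsplit _ (norm_nonneg _), ← Finset.sum_mul, EuclideanSpace.norm_sq_eq]
          simp only [Real.norm_eq_abs]
  have hnonneg : 0 ≤ ∑ i, |x i| ^ p :=
    Finset.sum_nonneg fun i _ => Real.rpow_nonneg (abs_nonneg _) _
  calc lpNorm p x ≤ (‖x‖ ^ p) ^ (1 / p) :=
        Real.rpow_le_rpow hnonneg hsum (by positivity)
    _ = ‖x‖ := by
        rw [one_div, Real.rpow_rpow_inv (norm_nonneg _) hp0.ne']

/-- Quadratic bound on the first-order Taylor remainder of a function with Lipschitz gradient. -/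
theorem abs_sub_sub_inner_le_of_lipschitz_gradient {E : Type*} [NormedAddCommGroup E]
    [InnerProductSpace ℝ E] [CompleteSpace E] {L : ℝ} {f : E → ℝ} {f' : E → E}
    (hdiff : ∀ x, HasGradientAt f (f' x) x)
    (hL : ∀ x y, ‖f' x - f' y‖ ≤ L * ‖x - y‖) (x w : E) :
    |f (x + w) - f x - ⟪f' x, w⟫| ≤ L / 2 * ‖w‖ ^ 2 := by
  have hderiv : ∀ t : ℝ, HasDerivAt (fun t : ℝ => f (x + t • w) - f x - t * ⟪f' x, w⟫)
      ⟪f' (x + t • w) - f' x, w⟫ t := fun t => by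
    have hline : HasDerivAt (fun t : ℝ => x + t • w) w t := by
      simpa using ((hasDerivAt_id t).smul_const w).const_add x
    have hcomp := (hdiff (x + t • w)).hasFDerivAt.comp_hasDerivAt t hline
    have := (hcomp.sub_const (f x)).sub ((hasDerivAt_id t).mul_const ⟪f' x, w⟫)
    refine this.congr_deriv ?_
    simp [inner_sub_left]
  have hB : ∀ t : ℝ, HasDerivAt (fun t : ℝ => L / 2 * ‖w‖ ^ 2 * t ^ 2) (L * ‖w‖ ^ 2 * t) t :=
    fun t => by
      have := (hasDerivAt_pow 2 t).const_mul (L / 2 * ‖w‖ ^ 2)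
      refine this.congr_deriv ?_
      push_cast
      ring
  have key := image_norm_le_of_norm_deriv_right_le_deriv_boundary (a := 0) (b := 1)
    (f := fun t : ℝ => f (x + t • w) - f x - t * ⟪f' x, w⟫)
    (fun t _ => (hderiv t).continuousAt.continuousWithinAt)
    (fun t _ => (hderiv t).hasDerivWithinAt)
    (by simp) hB
    (fun t ht => by
      calc ‖⟪f' (x + t • w) - f' x, w⟫‖ ≤ ‖f' (x + t • w) - f' x‖ * ‖w‖ := norm_inner_le_norm _ _
        _ ≤ (L * ‖x + t • w - x‖) * ‖w‖ := by gcongr; exact hL _ _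
        _ = L * ‖w‖ ^ 2 * t := by
          rw [add_sub_cancel_left, norm_smul, Real.norm_of_nonneg ht.1]
          ring)
    (Set.right_mem_Icc.2 zero_le_one)
  simpa using key

/-- Lemma 2.5 of the paper: bias bound for the smoothed gradient
`g_ν(x) = E_u[((f(x+νu) − f(x))/ν)·u]` of an `L_f`-smooth function, in ℓ_p-norm. -/
theorem smoothed_gradient_bias
    {d : ℕ} (hd : 1 ≤ d) {p : ℝ} (hp : 2 ≤ p) {ν Lf : ℝ} (hν : 0 < ν)
    (f : EuclideanSpace ℝ (Fin d) → ℝ)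
    (f' : EuclideanSpace ℝ (Fin d) → EuclideanSpace ℝ (Fin d))
    (hdiff : ∀ x, HasGradientAt f (f' x) x)
    (hLf : ∀ x y, ‖f' x - f' y‖ ≤ Lf * ‖x - y‖)
    {Ω : Type*} [MeasurableSpace Ω] (μ : Measure Ω) [IsProbabilityMeasure μ]
    (u : Ω → EuclideanSpace ℝ (Fin d)) (hu : Measurable u)
    (hmom : Integrable (fun ω => ‖u ω‖ ^ 3) μ)
    (hId : ∀ i j, (∫ ω, u ω i * u ω j ∂μ) = if i = j then (1:ℝ) else 0)
    (x : EuclideanSpace ℝ (Fin d)) :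
    lpNorm p ((∫ ω, ((f (x + ν • u ω) - f x) / ν) • u ω ∂μ) - f' x)
      ≤ ν * Lf / 2 * ∫ ω, ‖u ω‖ ^ 3 ∂μ := by
  have hf : Continuous f := continuous_iff_continuousAt.2 fun y => (hdiff y).continuousAt
  have hrem : ∀ ω, ‖((f (x + ν • u ω) - f x) / ν) • u ω - ⟪f' x, u ω⟫ • u ω‖
      ≤ ν * Lf / 2 * ‖u ω‖ ^ 3 := fun ω => by
    have h := abs_sub_sub_inner_le_of_lipschitz_gradient hdiff hLf x (ν • u ω)
    have heq : (f (x + ν • u ω) - f x) / ν - ⟪f' x, u ω⟫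
        = (f (x + ν • u ω) - f x - ⟪f' x, ν • u ω⟫) / ν := by
      rw [inner_smul_right]
      field_simp
    rw [← sub_smul, norm_smul, heq, Real.norm_eq_abs, abs_div, abs_of_pos hν]
    calc _ ≤ Lf / 2 * ‖ν • u ω‖ ^ 2 / ν * ‖u ω‖ := by gcongr
      _ = ν * Lf / 2 * ‖u ω‖ ^ 3 := by
        rw [norm_smul, Real.norm_of_nonneg hν.le]
        field_simp
  have hsq : Integrable (fun ω => ‖u ω‖ ^ 2) μ := by
    refine ((integrable_const (1 : ℝ)).add hmom).mono' (by fun_prop) (.of_forall fun ω => ?_)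
    have h0 := norm_nonneg (u ω)
    simp only [Pi.add_apply, norm_pow, norm_norm]
    nlinarith [mul_nonneg h0 (sq_nonneg (‖u ω‖ - 1)), sq_nonneg (‖u ω‖ - 1)]
  have hlin : Integrable (fun ω => ⟪f' x, u ω⟫ • u ω) μ := by
    refine (hsq.const_mul ‖f' x‖).mono' (by fun_prop) (.of_forall fun ω => ?_)
    rw [norm_smul, sq, ← mul_assoc]
    gcongr
    exact norm_inner_le_norm _ _
  have hmeas : AEStronglyMeasurable
      (fun ω => ((f (x + ν • u ω) - f x) / ν) • u ω - ⟪f' x, u ω⟫ • u ω) μ := by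
    have := hf.measurable
    fun_prop
  have hdiffint := (hmom.const_mul (ν * Lf / 2)).mono' hmeas (.of_forall hrem)
  have hint : Integrable (fun ω => ((f (x + ν • u ω) - f x) / ν) • u ω) μ := by
    refine (hdiffint.add hlin).congr (.of_forall fun ω => ?_)
    simp only [Pi.add_apply, sub_add_cancel]
  have hcoord : ∀ i j, Integrable (fun ω => u ω i * u ω j) μ := fun i j => by
    refine hsq.mono' (by fun_prop) (.of_forall fun ω => ?_)
    rw [norm_mul, sq]
    gcongr <;> exact PiLp.norm_apply_le _ _
  have hmean : ∫ ω, ⟪f' x, u ω⟫ • u ω ∂μ = f' x := by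
    ext j
    have hproj := (EuclideanSpace.proj (𝕜 := ℝ) j).integral_comp_comm hlin
    simp only [PiLp.proj_apply] at hproj
    rw [← hproj]
    have hexp : ∀ ω, (⟪f' x, u ω⟫ • u ω) j = ∑ i, f' x i * (u ω i * u ω j) := fun ω => by
      simp only [PiLp.smul_apply, smul_eq_mul, PiLp.inner_apply, Finset.sum_mul]
      exact Finset.sum_congr rfl fun i _ => by simp; ring
    simp only [hexp]
    rw [integral_finsetSum _ fun i _ => (hcoord i j).const_mul _]
    simp [integral_const_mul, hId]
  refine (lpNorm_le_norm hp _).trans ?_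
  conv_lhs => rw [← hmean]
  rw [← integral_sub hint hlin, ← integral_const_mul]
  exact norm_integral_le_of_norm_le (hmom.const_mul _) (.of_forall hrem)
end

section
/- Let X ⊆ ℝ^d be nonempty, closed and convex, h : ℝ^d → ℝ convex, v : ℝ^d → ℝ differentiable and 1-strongly convex w.r.t. a norm on ℝ^d, and η > 0. For g ∈ ℝ^d define the generalized gradient mapping G_X(x, g, η) = (x − x⁺)/η where x⁺ is the (unique) minimizer over y ∈ X of ⟨g, y⟩ + h(y) + (1/η)V(x, y), with V(x,y) = v(y) − v(x) − ⟨∇v(x), y − x⟩. Let f : ℝ^d → ℝ and c = (c₁,…,c_m) : ℝ^d → ℝ^m be differentiable at x ∈ X, and λ ∈ ℝ^m. If G_X(x, ∇f(x) + ∇c(x)ᵀλ, η) = 0, then there exist a subgradient ξ_h of h at x (i.e. h(y) ≥ h(x) + ⟨ξ_h, y − x⟩ for all y ∈ ℝ^d) and a vector w in the normal cone N_X(x) (i.e. ⟨w, y − x⟩ ≤ 0 for all y ∈ X) such that ∇f(x) + ∇c(x)ᵀλ + ξ_h + w = 0. -/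
open MeasureTheory Finset
open scoped RealInnerProductSpace

/-- A convex function that is minimised over a convex set `X` at `x ∈ X` has a subgradient at `x`
whose negative lies in the normal cone of `X` at `x`. -/
theorem exists_subgradient_of_isMinOn {E : Type*} [NormedAddCommGroup E]
    [InnerProductSpace ℝ E] [CompleteSpace E] {φ : E → ℝ} (hφ : ConvexOn ℝ Set.univ φ)
    (hφc : Continuous φ) {X : Set E} (hX : Convex ℝ X) {x : E} (hx : x ∈ X)
    (hmin : IsMinOn φ X x) :
    ∃ a : E, (∀ y, φ x + (⟪a, y - x⟫ : ℝ) ≤ φ y) ∧ ∀ y ∈ X, 0 ≤ (⟪a, y - x⟫ : ℝ) := by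
  have hopen : IsOpen {p : E × ℝ | p.1 ∈ Set.univ ∧ φ p.1 < p.2} := by
    simpa using isOpen_lt (hφc.comp continuous_fst) continuous_snd
  have hdisj : Disjoint {p : E × ℝ | p.1 ∈ Set.univ ∧ φ p.1 < p.2} (X ×ˢ Set.Iic (φ x)) := by
    rw [Set.disjoint_left]
    rintro ⟨y, r⟩ ⟨-, hr⟩ ⟨hy, hr'⟩
    exact absurd (hmin hy) (not_le.2 (hr.trans_le hr'))
  obtain ⟨F, u, hF, hu⟩ := geometric_hahn_banach_open hφ.convex_strict_epigraph hopen
    (hX.prod (convex_Iic (φ x))) hdisj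
  set β := F (0, 1)
  set l : E →L[ℝ] ℝ := F.comp (ContinuousLinearMap.inl ℝ E ℝ)
  have hFl (y : E) (r : ℝ) : F (y, r) = l y + r * β := by
    have : ((y, r) : E × ℝ) = (y, 0) + r • (0, 1) := by simp
    rw [this, map_add, map_smul]
    rfl
  have hFs (y : E) (r : ℝ) (hr : φ y < r) : l y + r * β < u := hFl y r ▸ hF (y, r) ⟨trivial, hr⟩
  have hux (y : E) (hy : y ∈ X) : u ≤ l y + φ x * β :=
    hFl y (φ x) ▸ hu (y, φ x) ⟨hy, Set.mem_Iic.2 le_rfl⟩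
  have hβ : β < 0 := by
    linarith [hFs x (φ x + 1) (lt_add_one _), hux x hx]
  have hle (y : E) : l y + φ y * β ≤ u := by
    refine le_of_forall_pos_le_add fun ε hε => ?_
    have := hFs y (φ y + ε / -β) (lt_add_of_pos_right _ (div_pos hε (neg_pos.2 hβ)))
    have h' : ε / -β * β = -ε := by rw [div_neg, neg_mul, div_mul_cancel₀ _ hβ.ne]
    linarith
  have hinner (y : E) :
      (⟪(-β)⁻¹ • (InnerProductSpace.toDual ℝ E).symm l, y - x⟫ : ℝ) = (l y - l x) / -β := by
    rw [real_inner_smul_left, InnerProductSpace.toDual_symm_apply, map_sub, div_eq_inv_mul]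
  refine ⟨(-β)⁻¹ • (InnerProductSpace.toDual ℝ E).symm l, fun y => ?_, fun y hy => ?_⟩
  · rw [hinner, ← le_sub_iff_add_le', div_le_iff₀ (neg_pos.2 hβ)]
    linarith [hle y, hux x hx]
  · rw [hinner]
    exact div_nonneg (by linarith [hle x, hux y hy]) (neg_pos.2 hβ).le

/-- If `x` minimises over `X` the sum of a convex function `φ` and a multiple of the first-order
Taylor remainder at `x` of a function differentiable there, then `x` minimises `φ` over `X`. -/
theorem isMinOn_of_le_add_remainder {E : Type*} [NormedAddCommGroup E]
    [InnerProductSpace ℝ E] [CompleteSpace E] {φ : E → ℝ} {X : Set E} (hφ : ConvexOn ℝ X φ)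
    {x : E} (hx : x ∈ X) {v : E → ℝ} {v' : E}
    (hv : HasGradientAt v v' x) {κ : ℝ}
    (hle : ∀ y ∈ X, φ x ≤ φ y + κ * (v y - v x - (⟪v', y - x⟫ : ℝ))) :
    IsMinOn φ X x := by
  intro y hy
  have hline : HasDerivAt (fun t : ℝ => x + t • (y - x)) (y - x) 0 := by
    simpa using ((hasDerivAt_id (0 : ℝ)).smul_const (y - x)).const_add x
  have hv0 : HasFDerivAt v (InnerProductSpace.toDual ℝ E v') (x + (0 : ℝ) • (y - x)) := by
    simpa using hv.hasFDerivAt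
  have hslope := (hv0.comp_hasDerivAt (0 : ℝ) hline).tendsto_slope_zero_right
  have hlim : Filter.Tendsto (fun t : ℝ =>
      φ y + κ * (t⁻¹ • (v (x + t • (y - x)) - v x) - (⟪v', y - x⟫ : ℝ)))
      (nhdsWithin 0 (Set.Ioi 0)) (nhds (φ y)) := by
    simpa using ((hslope.sub_const (⟪v', y - x⟫ : ℝ)).const_mul κ).const_add (φ y)
  refine ge_of_tendsto hlim ?_
  filter_upwards [Ioo_mem_nhdsGT (zero_lt_one (α := ℝ))] with t ht
  have hcomb : (1 - t) • x + t • y = x + t • (y - x) := by module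
  have hmem := hφ.1 hx hy (sub_nonneg.2 ht.2.le) ht.1.le (sub_add_cancel 1 t)
  have hconv := hφ.2 hx hy (sub_nonneg.2 ht.2.le) ht.1.le (sub_add_cancel 1 t)
  rw [hcomb] at hmem hconv
  have hmin := hle _ hmem
  rw [add_sub_cancel_left, real_inner_smul_right] at hmin
  simp only [smul_eq_mul] at hconv ⊢
  have ht0 := ht.1
  refine le_of_mul_le_mul_left ?_ ht0
  have hcancel : t * (φ y + κ * (t⁻¹ * (v (x + t • (y - x)) - v x) - (⟪v', y - x⟫ : ℝ)))
      = t * φ y + κ * (v (x + t • (y - x)) - v x - t * (⟪v', y - x⟫ : ℝ)) := by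
    field_simp
  linarith

/-- Lemma 3.1: if the generalized gradient mapping vanishes at `x`, then `x`
satisfies the KKT-type inclusion `0 ∈ ∇f(x) + ∇c(x)ᵀλ + ∂h(x) + N_X(x)`. -/
theorem gradient_mapping_zero_implies_KKT
    {d m : ℕ}
    (X : Set (EuclideanSpace ℝ (Fin d)))
    (hXne : X.Nonempty) (hXcl : IsClosed X) (hXconv : Convex ℝ X)
    (h : EuclideanSpace ℝ (Fin d) → ℝ) (hconv : ConvexOn ℝ Set.univ h)
    -- `v` is differentiable and 1-strongly convex w.r.t. a norm `N` on ℝ^d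
    (v : EuclideanSpace ℝ (Fin d) → ℝ)
    (v' : EuclideanSpace ℝ (Fin d) → EuclideanSpace ℝ (Fin d))
    (hv : ∀ z, HasGradientAt v (v' z) z)
    (N : EuclideanSpace ℝ (Fin d) → ℝ)
    (hN0 : ∀ z, 0 ≤ N z) (hNdef : ∀ z, N z = 0 → z = 0)
    (hNadd : ∀ z w, N (z + w) ≤ N z + N w)
    (hNsmul : ∀ (t : ℝ) z, N (t • z) = |t| * N z)
    (hsc : ∀ a b, (⟪a - b, v' a - v' b⟫ : ℝ) ≥ (N (a - b)) ^ 2)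
    {η : ℝ} (hη : 0 < η)
    (f : EuclideanSpace ℝ (Fin d) → ℝ) (c : Fin m → EuclideanSpace ℝ (Fin d) → ℝ)
    (x : EuclideanSpace ℝ (Fin d)) (hx : x ∈ X)
    (gradf : EuclideanSpace ℝ (Fin d)) (gradc : Fin m → EuclideanSpace ℝ (Fin d))
    (hdf : HasGradientAt f gradf x) (hdc : ∀ i, HasGradientAt (c i) (gradc i) x)
    (lam : Fin m → ℝ)
    -- `x⁺` is the minimizer over `X` of `⟨g, y⟩ + h(y) + (1/η) V(x, y)` with
    -- `g = ∇f(x) + ∇c(x)ᵀλ` and `V(x,y) = v(y) − v(x) − ⟨∇v(x), y − x⟩`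
    (xp : EuclideanSpace ℝ (Fin d)) (hxpX : xp ∈ X)
    (hxpmin : ∀ y ∈ X,
      (⟪gradf + ∑ i, lam i • gradc i, xp⟫ : ℝ) + h xp
          + (1 / η) * (v xp - v x - (⟪v' x, xp - x⟫ : ℝ))
        ≤ (⟪gradf + ∑ i, lam i • gradc i, y⟫ : ℝ) + h y
          + (1 / η) * (v y - v x - (⟪v' x, y - x⟫ : ℝ)))
    -- the generalized gradient mapping `G_X(x, g, η) = (x − x⁺)/η` vanishes
    (hG : (1 / η) • (x - xp) = 0) :
    ∃ ξh w : EuclideanSpace ℝ (Fin d),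
      (∀ y, h y ≥ h x + (⟪ξh, y - x⟫ : ℝ)) ∧
      (∀ y ∈ X, (⟪w, y - x⟫ : ℝ) ≤ 0) ∧
      gradf + ∑ i, lam i • gradc i + ξh + w = 0 := by
  obtain rfl : x = xp := by
    rcases smul_eq_zero.1 hG with h0 | h0
    · exact absurd h0 (one_div_pos.2 hη).ne'
    · exact sub_eq_zero.1 h0
  set g := gradf + ∑ i, lam i • gradc i
  have hφ : ConvexOn ℝ Set.univ fun y => (⟪g, y⟫ : ℝ) + h y :=
    ((innerₛₗ ℝ g).convexOn convex_univ).add hconv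
  have hφc : Continuous fun y => (⟪g, y⟫ : ℝ) + h y :=
    (continuous_const.inner continuous_id).add
      (continuousOn_univ.1 (hconv.continuousOn isOpen_univ))
  have hmin := isMinOn_of_le_add_remainder (hφ.subset (Set.subset_univ X) hXconv) hx (hv x)
    (κ := 1 / η) fun y hy => by simpa using hxpmin y hy
  obtain ⟨a, ha, haX⟩ := exists_subgradient_of_isMinOn hφ hφc hXconv hx hmin
  refine ⟨a - g, -a, fun y => ?_, fun y hy => ?_, by abel⟩
  · have := ha y
    rw [inner_sub_left, inner_sub_right g]
    linarith
  · rw [inner_neg_left]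
    exact neg_nonpos.2 (haX y hy)
end

section
/- For any real p ≥ 2, the function x ↦ ‖x‖_p² on ℝ^d is differentiable, and for all x, y ∈ ℝ^d it holds that ‖x + y‖_p² ≤ ‖x‖_p² + ⟨g_x, y⟩ + (p − 1)‖y‖_p², where g_x is the gradient of ‖·‖_p² at x. -/
open MeasureTheory Finset
open scoped RealInnerProductSpace

/-- The derivative of `s ↦ |s| ^ q * s` is `(q + 1) * |s| ^ q`. -/
theorem hasDerivAt_abs_rpow_mul_self {q : ℝ} (hq : 0 ≤ q) (s : ℝ) :
    HasDerivAt (fun s : ℝ => |s| ^ q * s) ((q + 1) * |s| ^ q) s := by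
  rcases hq.eq_or_lt with rfl | hq
  · simpa using hasDerivAt_id' s
  rcases eq_or_ne s 0 with rfl | hs
  · rw [abs_zero, Real.zero_rpow hq.ne', mul_zero, hasDerivAt_iff_tendsto_slope]
    have hc : ContinuousAt (fun s : ℝ => |s| ^ q) 0 :=
      continuous_abs.continuousAt.rpow_const (Or.inr hq.le)
    have ht := hc.tendsto.mono_left (nhdsWithin_le_nhds (s := {(0 : ℝ)}ᶜ))
    simp only [abs_zero, Real.zero_rpow hq.ne'] at ht
    refine ht.congr' ?_
    filter_upwards [self_mem_nhdsWithin] with t ht0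
    have : t ≠ 0 := ht0
    simp [slope_def_field, this]
  · have h := ((hasDerivAt_abs hs).rpow_const (p := q) (Or.inl (abs_ne_zero.2 hs))).mul
      (hasDerivAt_id' s)
    refine h.congr_deriv ?_
    have h1 : |s| ^ q = |s| ^ (q - 1) * |s| := by
      rw [← Real.rpow_add_one (abs_ne_zero.2 hs)]; ring_nf
    have h2 : (SignType.sign s : ℝ) * s = |s| := sign_mul_self s
    rw [h1]
    linear_combination q * |s| ^ (q - 1) * h2

/-- Hölder's inequality with exponents `p / (p - 2)` and `p / 2`. -/
theorem sum_abs_rpow_sub_two_mul_sq_le {ι : Type*} [Fintype ι] {p : ℝ} (hp : 2 ≤ p)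
    (u v : ι → ℝ) :
    ∑ i, |u i| ^ (p - 2) * v i ^ 2
      ≤ (∑ i, |u i| ^ p) ^ (1 - 2 / p) * (∑ i, |v i| ^ p) ^ (2 / p) := by
  rcases hp.eq_or_lt with rfl | hp
  · simp
  have hpq : (p / (p - 2)).HolderConjugate (p / 2) := by
    rw [Real.holderConjugate_iff]
    have : p - 2 ≠ 0 := by linarith
    refine ⟨by rw [lt_div_iff₀] <;> linarith, by field_simp; ring⟩
  have h := Real.inner_le_Lp_mul_Lq_of_nonneg univ hpq (f := fun i => |u i| ^ (p - 2))
    (g := fun i => v i ^ 2) (fun _ _ => by positivity) (fun _ _ => by positivity)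
  refine h.trans_eq ?_
  have h1 : 1 / (p / (p - 2)) = 1 - 2 / p := by
    have : p - 2 ≠ 0 := by linarith
    field_simp
  have h2 : 1 / (p / 2) = 2 / p := by field_simp
  rw [h1, h2]
  congr 3 with i
  · rw [← Real.rpow_mul (abs_nonneg _)]
    congr 1
    have : p - 2 ≠ 0 := by linarith
    field_simp
  · rw [← sq_abs, ← Real.rpow_natCast, ← Real.rpow_mul (abs_nonneg _)]
    congr 1
    push_cast
    field_simp

/-- A function whose second derivative is at most `2 * K` lies below its second-order
expansion with quadratic coefficient `K`. -/
theorem le_add_deriv_add_of_second_deriv_le {f f' f'' : ℝ → ℝ} {K : ℝ}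
    (hf : ∀ t, HasDerivAt f (f' t) t) (hf' : ∀ t, HasDerivAt f' (f'' t) t)
    (hK : ∀ t, f'' t ≤ 2 * K) : f 1 ≤ f 0 + f' 0 + K := by
  have h' : ∀ t, HasDerivAt (fun t => 2 * K * t - f' t) (2 * K - f'' t) t := fun t =>
    (((hasDerivAt_id' t).const_mul (2 * K)).sub (hf' t)).congr_deriv (by ring)
  have hmono : Monotone fun t => 2 * K * t - f' t :=
    monotone_of_deriv_nonneg (fun t => (h' t).differentiableAt) fun t => by
      rw [(h' t).deriv]; linarith [hK t]
  have h : ∀ t, HasDerivAt (fun t => K * t ^ 2 + f' 0 * t - f t)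
      (2 * K * t + f' 0 - f' t) t := fun t =>
    ((((hasDerivAt_pow 2 t).const_mul K).add ((hasDerivAt_id' t).const_mul (f' 0))).sub
      (hf t)).congr_deriv (by push_cast; ring)
  have hmono' : MonotoneOn (fun t => K * t ^ 2 + f' 0 * t - f t) (Set.Icc 0 1) := by
    refine monotoneOn_of_deriv_nonneg (convex_Icc 0 1)
      (fun t _ => (h t).continuousAt.continuousWithinAt)
      (fun t _ => (h t).differentiableAt.differentiableWithinAt) fun t ht => ?_
    rw [interior_Icc] at ht
    have := hmono ht.1.le
    rw [(h t).deriv]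
    simp only at this
    linarith
  have := hmono' (Set.left_mem_Icc.2 zero_le_one) (Set.right_mem_Icc.2 zero_le_one) zero_le_one
  simp only at this
  linarith

theorem sum_abs_rpow_line_le_of_pos {ι : Type*} [Fintype ι] {p : ℝ} (hp : 2 ≤ p) (x y : ι → ℝ)
    (hpos : ∀ t : ℝ, 0 < ∑ i, |x i + t * y i| ^ p) :
    (∑ i, |x i + y i| ^ p) ^ (2 / p) ≤ (∑ i, |x i| ^ p) ^ (2 / p)
      + deriv (fun t : ℝ => (∑ i, |x i + t * y i| ^ p) ^ (2 / p)) 0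
      + (p - 1) * (∑ i, |y i| ^ p) ^ (2 / p) := by
  have hp0 : p ≠ 0 := by linarith
  have hline : ∀ i t, HasDerivAt (fun t : ℝ => x i + t * y i) (y i) t := fun i t => by
    simpa using ((hasDerivAt_id' t).mul_const (y i)).const_add (x i)
  set S : ℝ → ℝ := fun t => ∑ i, |x i + t * y i| ^ p with hS
  set A : ℝ → ℝ := fun t => ∑ i, |x i + t * y i| ^ (p - 2) * (x i + t * y i) * y i with hA
  set B : ℝ → ℝ := fun t => ∑ i, |x i + t * y i| ^ (p - 2) * y i ^ 2 with hB
  have hS' : ∀ t, HasDerivAt S (p * A t) t := fun t => by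
    have := HasDerivAt.fun_sum (u := univ) fun i _ =>
      (hasDerivAt_abs_rpow (x i + t * y i) (by linarith : 1 < p)).comp t (hline i t)
    refine this.congr_deriv ?_
    rw [hA, mul_sum]
    exact sum_congr rfl fun i _ => by ring
  have hA' : ∀ t, HasDerivAt A ((p - 1) * B t) t := fun t => by
    have := HasDerivAt.fun_sum (u := univ) fun i _ =>
      ((hasDerivAt_abs_rpow_mul_self (by linarith : 0 ≤ p - 2) (x i + t * y i)).comp t
        (hline i t)).mul_const (y i)
    refine this.congr_deriv ?_
    rw [hB, mul_sum]
    exact sum_congr rfl fun i _ => by ring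
  have hf : ∀ t, HasDerivAt (fun t => S t ^ (2 / p)) (2 * S t ^ (2 / p - 1) * A t) t := fun t =>
    ((hS' t).rpow_const (Or.inl (hpos t).ne')).congr_deriv (by field_simp)
  have hf' : ∀ t, HasDerivAt (fun t => 2 * S t ^ (2 / p - 1) * A t)
      (2 * (p - 1) * S t ^ (2 / p - 1) * B t
        - 2 * (p - 2) * S t ^ (2 / p - 1 - 1) * A t ^ 2) t := fun t =>
    ((((hS' t).rpow_const (p := 2 / p - 1) (Or.inl (hpos t).ne')).const_mul 2).mul
      (hA' t)).congr_deriv (by field_simp; ring)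
  have key := le_add_deriv_add_of_second_deriv_le hf hf'
    (K := (p - 1) * (∑ i, |y i| ^ p) ^ (2 / p)) fun t => by
      have hSt : 0 < S t := hpos t
      have h1 : 0 ≤ 2 * (p - 2) * S t ^ (2 / p - 1 - 1) * A t ^ 2 := by
        have : 0 ≤ p - 2 := by linarith
        positivity
      have h2 : S t ^ (2 / p - 1) * B t ≤ (∑ i, |y i| ^ p) ^ (2 / p) := by
        calc S t ^ (2 / p - 1) * B t
            ≤ S t ^ (2 / p - 1) * (S t ^ (1 - 2 / p) * (∑ i, |y i| ^ p) ^ (2 / p)) := by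
              gcongr
              exact sum_abs_rpow_sub_two_mul_sq_le hp _ _
          _ = (∑ i, |y i| ^ p) ^ (2 / p) := by
              rw [← mul_assoc, ← Real.rpow_add hSt]
              simp
      have h3 := mul_le_mul_of_nonneg_left h2 (by linarith : 0 ≤ 2 * (p - 1))
      linarith
  rw [(hf 0).deriv]
  simpa [hS] using key

theorem sum_abs_const_mul_rpow {ι : Type*} [Fintype ι] {p : ℝ} (hp : p ≠ 0) (c : ℝ)
    (y : ι → ℝ) :
    (∑ i, |c * y i| ^ p) ^ (2 / p) = c ^ 2 * (∑ i, |y i| ^ p) ^ (2 / p) := by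
  simp_rw [abs_mul, Real.mul_rpow (abs_nonneg c) (abs_nonneg _), ← mul_sum]
  rw [Real.mul_rpow (by positivity) (by positivity), ← Real.rpow_mul (abs_nonneg c),
    mul_div_cancel₀ _ hp, Real.rpow_two, sq_abs]

/-- Smoothness of the squared `ℓ_p` norm along a line. -/
theorem sum_abs_rpow_line_le {ι : Type*} [Fintype ι] {p : ℝ} (hp : 2 ≤ p) (x y : ι → ℝ) :
    (∑ i, |x i + y i| ^ p) ^ (2 / p) ≤ (∑ i, |x i| ^ p) ^ (2 / p)
      + deriv (fun t : ℝ => (∑ i, |x i + t * y i| ^ p) ^ (2 / p)) 0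
      + (p - 1) * (∑ i, |y i| ^ p) ^ (2 / p) := by
  have hp0 : p ≠ 0 := by linarith
  by_cases hpos : ∀ t : ℝ, 0 < ∑ i, |x i + t * y i| ^ p
  · exact sum_abs_rpow_line_le_of_pos hp x y hpos
  push Not at hpos
  obtain ⟨t, ht⟩ := hpos
  have hx : ∀ i, x i = -t * y i := fun i => by
    have h0 := (sum_eq_zero_iff_of_nonneg fun i _ => by positivity).1
      (ht.antisymm (sum_nonneg fun i _ => by positivity)) i (mem_univ i)
    have := abs_eq_zero.1 ((Real.rpow_eq_zero (abs_nonneg _) hp0).1 h0)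
    linarith
  have hadd : ∀ s i, x i + s * y i = (s - t) * y i := fun s i => by rw [hx]; ring
  have h1 : ∀ i, x i + y i = (1 - t) * y i := fun i => by rw [hx]; ring
  simp_rw [hadd, h1, hx, sum_abs_const_mul_rpow hp0]
  set N := (∑ i, |y i| ^ p) ^ (2 / p)
  have hN : 0 ≤ N := by positivity
  have hd : HasDerivAt (fun s : ℝ => (s - t) ^ 2 * N) (-2 * t * N) 0 :=
    ((((hasDerivAt_id' (0 : ℝ)).sub_const t).pow 2).mul_const N).congr_deriv (by
      push_cast; ring)
  rw [hd.deriv]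
  nlinarith

theorem differentiableAt_sum_abs_rpow_zero {d : ℕ} {p : ℝ} (hp : 2 ≤ p) :
    DifferentiableAt ℝ
      (fun z : EuclideanSpace ℝ (Fin d) => (∑ i, |z i| ^ p) ^ (2 / p)) 0 := by
  have hp0 : p ≠ 0 := by linarith
  have hbound : ∀ z : EuclideanSpace ℝ (Fin d),
      (∑ i, |z i| ^ p) ^ (2 / p) ≤ (d : ℝ) ^ (2 / p) * ‖z‖ ^ 2 := fun z => by
    have h : ∑ i, |z i| ^ p ≤ d * ‖z‖ ^ p := by
      calc ∑ i, |z i| ^ p ≤ ∑ _i : Fin d, ‖z‖ ^ p := by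
            gcongr with i
            exact PiLp.norm_apply_le z i
        _ = d * ‖z‖ ^ p := by simp
    calc (∑ i, |z i| ^ p) ^ (2 / p) ≤ (d * ‖z‖ ^ p) ^ (2 / p) := by gcongr
      _ = (d : ℝ) ^ (2 / p) * ‖z‖ ^ 2 := by
        rw [Real.mul_rpow (by positivity) (by positivity), ← Real.rpow_mul (norm_nonneg _),
          mul_div_cancel₀ _ hp0, Real.rpow_two]
  have hO : (fun z : EuclideanSpace ℝ (Fin d) => (∑ i, |z i| ^ p) ^ (2 / p))
      =O[nhds 0] fun z => ‖z - 0‖ ^ 2 :=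
    Asymptotics.IsBigO.of_bound ((d : ℝ) ^ (2 / p)) (Filter.Eventually.of_forall fun z => by
      rw [Real.norm_of_nonneg (by positivity), Real.norm_of_nonneg (by positivity), sub_zero]
      exact hbound z)
  exact (hO.hasFDerivAt one_lt_two).differentiableAt

theorem differentiable_sum_abs_rpow {d : ℕ} {p : ℝ} (hp : 2 ≤ p) :
    Differentiable ℝ
      (fun z : EuclideanSpace ℝ (Fin d) => (∑ i, |z i| ^ p) ^ (2 / p)) := by
  intro x
  rcases eq_or_ne x 0 with rfl | hx
  · exact differentiableAt_sum_abs_rpow_zero hp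
  have hsum : ∑ i, |x i| ^ p ≠ 0 := by
    obtain ⟨i, hi⟩ : ∃ i, x i ≠ 0 := by
      by_contra! h
      exact hx (PiLp.ext h)
    exact (sum_pos' (fun j _ => by positivity)
      ⟨i, mem_univ i, Real.rpow_pos_of_pos (abs_pos.2 hi) p⟩).ne'
  have hd : DifferentiableAt ℝ (fun z : EuclideanSpace ℝ (Fin d) => ∑ i, |z i| ^ p) x := by
    refine DifferentiableAt.fun_sum fun i _ => ?_
    have hi : DifferentiableAt ℝ (fun z : EuclideanSpace ℝ (Fin d) => z i) x := by fun_prop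
    exact (hasDerivAt_abs_rpow (x i) (by linarith : 1 < p)).differentiableAt.comp x hi
  exact hd.rpow_const (Or.inl hsum)

theorem lpNorm_sq_eq {d : ℕ} (p : ℝ) (x : EuclideanSpace ℝ (Fin d)) :
    lpNorm p x ^ 2 = (∑ i, |x i| ^ p) ^ (2 / p) := by
  rw [_root_.lpNorm, ← Real.rpow_natCast, ← Real.rpow_mul (by positivity)]
  congr 1
  push_cast
  ring

/-- Lemma 4.1: for `p ≥ 2` the squared ℓ_p-norm is differentiable, and
`‖x+y‖_p² ≤ ‖x‖_p² + ⟨g_x, y⟩ + (p−1)‖y‖_p²` where `g_x` is its gradient at `x`. -/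
theorem sq_lpNorm_smoothness
    {d : ℕ} {p : ℝ} (hp : 2 ≤ p) :
    ∀ x : EuclideanSpace ℝ (Fin d), ∃ gx : EuclideanSpace ℝ (Fin d),
      HasGradientAt (fun z => (lpNorm p z) ^ 2) gx x ∧
      ∀ y : EuclideanSpace ℝ (Fin d),
        (lpNorm p (x + y)) ^ 2
          ≤ (lpNorm p x) ^ 2 + (⟪gx, y⟫ : ℝ) + (p - 1) * (lpNorm p y) ^ 2 := by
  intro x
  simp_rw [lpNorm_sq_eq]
  have hd := (differentiable_sum_abs_rpow (d := d) hp x).hasGradientAt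
  refine ⟨_, hd, fun y => ?_⟩
  have hline : HasDerivAt (fun t : ℝ => x + t • y) y 0 := by
    simpa using ((hasDerivAt_id' (0 : ℝ)).smul_const y).const_add x
  have hcomp := HasFDerivAt.comp_hasDerivAt_of_eq (0 : ℝ) hd.hasFDerivAt hline (by simp)
  have h := sum_abs_rpow_line_le hp x y
  have hderiv := hcomp.deriv
  simp only [Function.comp_def, PiLp.add_apply, PiLp.smul_apply, smul_eq_mul,
    InnerProductSpace.toDual_apply_apply] at hderiv
  rw [hderiv] at h
  simpa using h
end

section
/- Let q ∈ (1, 2], p with 1/p + 1/q = 1, η > 0, and g̃ ∈ ℝ^d with g̃ ≠ 0. Then the function x ↦ ⟨g̃, x⟩ + (1/(2η))‖x‖_q² on ℝ^d has a unique global minimizer x*, given componentwise by x*ᵢ = −sgn(g̃ᵢ)·|η g̃ᵢ|^{1/(q−1)}·‖η g̃‖_p^{(q−2)/(q−1)}. -/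
open MeasureTheory Finset
open scoped RealInnerProductSpace

lemma abs_midpoint_rpow_lt {q : ℝ} (hq : 1 < q) {u v : ℝ} (huv : u ≠ v) :
    |(u + v) / 2| ^ q < (|u| ^ q + |v| ^ q) / 2 := by
  have hq0 : 0 < q := by linarith
  by_cases h : |u| = |v|
  · have hu : u = -v := (abs_eq_abs.mp h).resolve_left huv
    have hv : v ≠ 0 := by
      rintro rfl
      simp_all
    subst hu
    have : 0 < |v| ^ q := Real.rpow_pos_of_pos (abs_pos.mpr hv) q
    simpa [Real.zero_rpow hq0.ne'] using this
  · have hconv := (strictConvexOn_rpow hq).2 (Set.mem_Ici.mpr (abs_nonneg u))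
      (Set.mem_Ici.mpr (abs_nonneg v)) h
      one_half_pos one_half_pos (add_halves 1)
    simp only [smul_eq_mul] at hconv
    have hle : |(u + v) / 2| ≤ 1 / 2 * |u| + 1 / 2 * |v| := by
      rw [abs_div, abs_two]
      linarith [abs_add_le u v]
    calc |(u + v) / 2| ^ q ≤ (1 / 2 * |u| + 1 / 2 * |v|) ^ q := by gcongr
      _ < 1 / 2 * |u| ^ q + 1 / 2 * |v| ^ q := hconv
      _ = _ := by ring

section lpNorm

variable {d : ℕ} {p q : ℝ}

lemma lpNorm_nonneg (p : ℝ) (x : EuclideanSpace ℝ (Fin d)) : 0 ≤ _root_.lpNorm p x := by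
  unfold _root_.lpNorm
  positivity

lemma lpNorm_rpow (hp : p ≠ 0) (x : EuclideanSpace ℝ (Fin d)) :
    _root_.lpNorm p x ^ p = ∑ i, |x i| ^ p := by
  rw [_root_.lpNorm, ← Real.rpow_mul (by positivity), one_div_mul_cancel hp, Real.rpow_one]

lemma lpNorm_pos (p : ℝ) {x : EuclideanSpace ℝ (Fin d)} (hx : x ≠ 0) :
    0 < _root_.lpNorm p x := by
  obtain ⟨i, hi⟩ : ∃ i, x i ≠ 0 := by
    by_contra! h
    exact hx (by ext i; simpa using h i)
  refine Real.rpow_pos_of_pos (Finset.sum_pos' (fun j _ => by positivity) ⟨i, mem_univ i, ?_⟩) _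
  exact Real.rpow_pos_of_pos (abs_pos.mpr hi) p

lemma neg_lpNorm_mul_lpNorm_le_inner (hpq : p.HolderConjugate q)
    (h z : EuclideanSpace ℝ (Fin d)) :
    -(_root_.lpNorm p h * _root_.lpNorm q z) ≤ ⟪h, z⟫ := by
  have := Real.inner_le_Lp_mul_Lq univ (fun i => -h i) (fun i => z i) hpq
  simp only [abs_neg, neg_mul, sum_neg_distrib] at this
  simp only [_root_.lpNorm, PiLp.inner_apply, RCLike.inner_apply, conj_trivial]
  simp only [mul_comm (z _)]
  linarith

lemma eq_of_inner_eq_neg_sq (hpq : p.HolderConjugate q) {h x w : EuclideanSpace ℝ (Fin d)}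
    (hh : 0 < _root_.lpNorm p h)
    (hx : _root_.lpNorm q x = _root_.lpNorm p h) (hhx : ⟪h, x⟫ = -_root_.lpNorm p h ^ 2)
    (hw : _root_.lpNorm q w = _root_.lpNorm p h) (hhw : ⟪h, w⟫ = -_root_.lpNorm p h ^ 2) :
    w = x := by
  by_contra hne
  have hq1 : 1 < q := hpq.symm.lt
  obtain ⟨i, hi⟩ : ∃ i, w i ≠ x i := by
    by_contra! h
    exact hne (by ext i; exact h i)
  set m : EuclideanSpace ℝ (Fin d) := (1 / 2 : ℝ) • (w + x) with hm
  have hmi (j : Fin d) : m j = (w j + x j) / 2 := by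
    simp [hm]; ring
  have hinner : ⟪h, m⟫ = -_root_.lpNorm p h ^ 2 := by
    rw [hm, inner_smul_right, inner_add_right, hhx, hhw]
    ring
  have hle : _root_.lpNorm p h ≤ _root_.lpNorm q m := by
    have := neg_lpNorm_mul_lpNorm_le_inner hpq h m
    rw [hinner] at this
    nlinarith
  have hlt : ∑ j, |m j| ^ q < ∑ j, (|w j| ^ q + |x j| ^ q) / 2 := by
    refine Finset.sum_lt_sum (fun j _ => ?_) ⟨i, mem_univ i, ?_⟩
    · rw [hmi]
      rcases eq_or_ne (w j) (x j) with hj | hj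
      · simp [hj]
      · exact (abs_midpoint_rpow_lt hq1 hj).le
    · rw [hmi]
      exact abs_midpoint_rpow_lt hq1 hi
  have hq0 : q ≠ 0 := by linarith
  rw [← Finset.sum_div, Finset.sum_add_distrib, ← lpNorm_rpow hq0, ← lpNorm_rpow hq0,
    ← lpNorm_rpow hq0, hx, hw] at hlt
  have := Real.rpow_le_rpow hh.le hle (by linarith : 0 ≤ q)
  linarith

lemma lpNorm_eq_of_abs_apply (hpq : p.HolderConjugate q) {h x : EuclideanSpace ℝ (Fin d)}
    (hh : 0 < _root_.lpNorm p h)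
    (hx : ∀ i, |x i| = |h i| ^ (p - 1) * _root_.lpNorm p h ^ (2 - p)) :
    _root_.lpNorm q x = _root_.lpNorm p h := by
  have hq0 := hpq.symm.pos
  have hsum : ∑ i, |x i| ^ q = _root_.lpNorm p h ^ q := by
    have hterm (i : Fin d) : |x i| ^ q = |h i| ^ p * _root_.lpNorm p h ^ ((2 - p) * q) := by
      rw [hx, Real.mul_rpow (by positivity) (by positivity), ← Real.rpow_mul (abs_nonneg _),
        ← Real.rpow_mul hh.le, hpq.sub_one_mul_conj]
    simp_rw [hterm]
    rw [← Finset.sum_mul, ← lpNorm_rpow hpq.ne_zero, ← Real.rpow_add hh]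
    congr 1
    linarith [hpq.sub_one_mul_conj]
  rw [_root_.lpNorm, hsum, ← Real.rpow_mul hh.le, mul_one_div_cancel hq0.ne', Real.rpow_one]

lemma inner_eq_neg_sq_of_mul_apply (hp : p ≠ 0) {h x : EuclideanSpace ℝ (Fin d)}
    (hh : 0 < _root_.lpNorm p h)
    (hx : ∀ i, h i * x i = -(|h i| ^ p * _root_.lpNorm p h ^ (2 - p))) :
    ⟪h, x⟫ = -_root_.lpNorm p h ^ 2 := by
  simp only [PiLp.inner_apply, RCLike.inner_apply, conj_trivial]
  simp_rw [mul_comm (x _), hx]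
  rw [sum_neg_distrib, ← Finset.sum_mul, ← lpNorm_rpow hp, ← Real.rpow_add hh, ← Real.rpow_natCast]
  congr 2
  push_cast
  ring

end lpNorm

/-- Appendix A: explicit unique minimizer of
`x ↦ ⟨g̃, x⟩ + (1/(2η))‖x‖_q²` for `q ∈ (1,2]`, `1/p + 1/q = 1`, `η > 0`, `g̃ ≠ 0`. -/
theorem bregman_subproblem_solution
    {d : ℕ} (hd : 1 ≤ d) {p q η : ℝ} (hq1 : 1 < q) (hq2 : q ≤ 2)
    (hpq : 1 / p + 1 / q = 1) (hη : 0 < η)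
    (g : EuclideanSpace ℝ (Fin d)) (hg : g ≠ 0) :
    ∃ xstar : EuclideanSpace ℝ (Fin d),
      -- the explicit componentwise formula
      (∀ i, xstar i = -(Real.sign (g i)) * |η * g i| ^ (1 / (q - 1))
          * (lpNorm p (η • g)) ^ ((q - 2) / (q - 1))) ∧
      -- `xstar` is a global minimizer
      (∀ z : EuclideanSpace ℝ (Fin d),
        (⟪g, xstar⟫ : ℝ) + (1 / (2 * η)) * (lpNorm q xstar) ^ 2
          ≤ (⟪g, z⟫ : ℝ) + (1 / (2 * η)) * (lpNorm q z) ^ 2) ∧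
      -- and it is the unique one
      (∀ w : EuclideanSpace ℝ (Fin d),
        (∀ z : EuclideanSpace ℝ (Fin d),
          (⟪g, w⟫ : ℝ) + (1 / (2 * η)) * (lpNorm q w) ^ 2
            ≤ (⟪g, z⟫ : ℝ) + (1 / (2 * η)) * (lpNorm q z) ^ 2) → w = xstar) := by
  have hq0 : 0 < q := by linarith
  have hp0 : 0 < p := by
    have : 1 / q < 1 := by rw [div_lt_one hq0]; exact hq1
    exact one_div_pos.mp (by linarith)
  have hconj : p.HolderConjugate q :=
    ⟨by rw [inv_one]; simpa only [one_div] using hpq, hp0, hq0⟩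
  have hmul : (p - 1) * (q - 1) = 1 := by
    linear_combination hconj.sub_one_mul_conj
  have hexp : 1 / (q - 1) = p - 1 := by
    rw [div_eq_iff (by linarith), hmul]
  have hexp' : (q - 2) / (q - 1) = 2 - p := by
    rw [div_eq_iff (by linarith)]
    linear_combination hmul
  rw [hexp, hexp']
  have hh : 0 < _root_.lpNorm p (η • g) := lpNorm_pos p (smul_ne_zero hη.ne' hg)
  set H := _root_.lpNorm p (η • g) with hH
  obtain ⟨x, hx⟩ : ∃ x : EuclideanSpace ℝ (Fin d),
      ∀ i, x i = -(Real.sign (g i)) * |η * g i| ^ (p - 1) * H ^ (2 - p) :=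
    ⟨WithLp.toLp 2 fun i => -(Real.sign (g i)) * |η * g i| ^ (p - 1) * H ^ (2 - p), fun _ => rfl⟩
  have hp1 : p - 1 ≠ 0 := hconj.sub_one_pos.ne'
  have hxnorm : _root_.lpNorm q x = H := by
    refine lpNorm_eq_of_abs_apply hconj hh fun i => ?_
    rw [hx, PiLp.smul_apply, smul_eq_mul, abs_mul, abs_mul, abs_neg,
      abs_of_nonneg (by positivity : 0 ≤ |η * g i| ^ (p - 1)),
      abs_of_nonneg (by positivity : 0 ≤ H ^ (2 - p))]
    rcases lt_trichotomy (g i) 0 with hi | hi | hi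
    · simp [Real.sign_of_neg hi, hH]
    · simp [hi, Real.zero_rpow hp1]
    · simp [Real.sign_of_pos hi, hH]
  have hxinner : ⟪η • g, x⟫ = -H ^ 2 := by
    refine inner_eq_neg_sq_of_mul_apply hp0.ne' hh fun i => ?_
    rw [hx, PiLp.smul_apply, smul_eq_mul, ← hH]
    have habs : η * g i * Real.sign (g i) = |η * g i| := by
      rw [abs_mul, abs_of_pos hη, mul_assoc]
      rcases lt_trichotomy (g i) 0 with hi | hi | hi
      · simp [Real.sign_of_neg hi, abs_of_neg hi]
      · simp [hi]
      · simp [Real.sign_of_pos hi, abs_of_pos hi]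
    have hpow : |η * g i| * |η * g i| ^ (p - 1) = |η * g i| ^ p := by
      rw [mul_comm, ← Real.rpow_add_one' (abs_nonneg _) (by simpa using hp0.ne'), sub_add_cancel]
    rw [← hpow, ← habs]
    ring
  have hscale (z : EuclideanSpace ℝ (Fin d)) :
      η * (⟪g, z⟫ + (1 / (2 * η)) * _root_.lpNorm q z ^ 2)
        = ⟪η • g, z⟫ + _root_.lpNorm q z ^ 2 / 2 := by
    rw [real_inner_smul_left]
    field_simp
  have hbound (z : EuclideanSpace ℝ (Fin d)) : -(H * _root_.lpNorm q z) ≤ ⟪η • g, z⟫ :=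
    neg_lpNorm_mul_lpNorm_le_inner hconj _ z
  refine ⟨x, hx, fun z => ?_, fun w hw => ?_⟩
  · refine le_of_mul_le_mul_left ?_ hη
    rw [hscale, hscale, hxinner, hxnorm]
    nlinarith [hbound z, sq_nonneg (_root_.lpNorm q z - H)]
  · have hwx := mul_le_mul_of_nonneg_left (hw x) hη.le
    rw [hscale, hscale, hxinner, hxnorm] at hwx
    have hwnorm : _root_.lpNorm q w = H := by
      have : (_root_.lpNorm q w - H) ^ 2 ≤ 0 := by nlinarith [hbound w]
      exact sub_eq_zero.mp (pow_eq_zero_iff two_ne_zero |>.mp (le_antisymm this (sq_nonneg _)))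
    refine eq_of_inner_eq_neg_sq hconj hh hxnorm hxinner hwnorm (le_antisymm ?_ ?_)
    · rw [hwnorm] at hwx
      linarith
    · have := hbound w
      rw [hwnorm] at this
      linarith
end
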